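/- arXiv:1709.09484 — 3 statements merged into one kernel-verified Lean document; each statement's English description precedes it below -/
import Mathlib

section
/- For every First-in-first-out Routing Game (FROG) and every strategy profile, the FIFO dynamics determine a unique execution: for each agent i and each edge e of its chosen path there is a uniquely determined time at which i joins e's queue and a uniquely determined time at which i leaves the queue and enters e, every agent reaches its sink after finitely many time steps, and consequently the vector of total delays (C_1(π),…,C_n(π)) ∈ ℕ^n is well defined (the mapping from strategy profiles to total delays is a well-defined function). -/
/-!  A formal model of First-in-first-out Routing Games (FROGs).

A FROG is a finite digraph whose edges carry a capacity `c e ≥ 1` and a fixed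
delay `d e ≥ 0`, together with `n` agents, each having a source, a sink, a
starting time, and a tie-breaking priority (`prio i < prio j` means `i ≻ j`).
Strategies are simple directed paths from source to sink.  The FIFO dynamics
are axiomatized by the predicate `IsFIFO` on executions (join/enter times for
every agent and every edge of its path). -/

structure FROG where
  nV : ℕ
  E : Finset (Fin nV × Fin nV)
  c : Fin nV × Fin nV → ℕ
  d : Fin nV × Fin nV → ℕ
  n : ℕ
  src : Fin n → Fin nV
  sink : Fin n → Fin nV
  start : Fin n → ℕ
  prio : Fin n → ℕ
  prio_inj : Function.Injective prio
  c_pos : ∀ e ∈ E, 1 ≤ c e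

namespace FROG

/-- The type of (potential) edges of the digraph of `Γ`. -/
abbrev Edge (Γ : FROG) := Fin Γ.nV × Fin Γ.nV

/-- `IsPathFrom Γ u v p`: the list of edges `p` is a directed path from `u` to `v`
in the digraph of `Γ`. -/
def IsPathFrom (Γ : FROG) : Fin Γ.nV → Fin Γ.nV → List Γ.Edge → Prop
  | u, v, [] => u = v
  | u, v, e :: p => e.1 = u ∧ e ∈ Γ.E ∧ Γ.IsPathFrom e.2 v p

/-- A path starting at `u` is simple if it visits no vertex twice. -/
def IsSimple (Γ : FROG) (u : Fin Γ.nV) (p : List Γ.Edge) : Prop :=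
  (u :: p.map Prod.snd).Nodup

/-- The strategy set of agent `i`: simple directed paths from its source to its sink. -/
def Strat (Γ : FROG) (i : Fin Γ.n) :=
  {p : List Γ.Edge // Γ.IsPathFrom (Γ.src i) (Γ.sink i) p ∧ Γ.IsSimple (Γ.src i) p}

/-- A strategy profile: one simple source-sink path per agent. -/
abbrev Profile (Γ : FROG) := ∀ i : Fin Γ.n, Γ.Strat i

/-- An agent is degenerate when it has a unique strategy. -/
def Degenerate (Γ : FROG) (j : Fin Γ.n) : Prop := ∀ s s' : Γ.Strat j, s = s'

variable {Γ : FROG}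

/-- The `k`-th edge of the path of agent `i` in profile `π`. -/
def edgeAt (π : Γ.Profile) (i : Fin Γ.n) (k : Fin (π i).val.length) : Γ.Edge :=
  (π i).val.get k

/-- An execution records, for each agent `i` and each edge of its path, the time
at which `i` joins the FIFO queue of that edge and the time at which it leaves
the queue and enters the edge. -/
structure Execution (π : Γ.Profile) where
  join : ∀ i : Fin Γ.n, Fin (π i).val.length → ℕ
  enter : ∀ i : Fin Γ.n, Fin (π i).val.length → ℕ

/-- `Ahead π ex j l i k`: in execution `ex`, agent `j` (at the `l`-th edge of its
path) is queued ahead of agent `i` (at the `k`-th edge of its path) on the same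
edge: it joined strictly earlier, or at the same time step with higher priority. -/
def Ahead (π : Γ.Profile) (ex : Execution π) (j : Fin Γ.n) (l : Fin (π j).val.length)
    (i : Fin Γ.n) (k : Fin (π i).val.length) : Prop :=
  edgeAt π j l = edgeAt π i k ∧ (j ≠ i ∨ l.val ≠ k.val) ∧
    (ex.join j l < ex.join i k ∨ (ex.join j l = ex.join i k ∧ Γ.prio j < Γ.prio i))

/-- The FIFO dynamics: agents start on the first edge of their path at their
starting time; queue joining times are enter time plus fixed delay of the
previous edge; the queue discipline never lets an agent overtake an agent ahead
of it; at each time step at most `c e` agents enter `e`; and service is eager: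
an agent still waiting at time `t` does so only because `c e` agents ahead of
it enter the edge at time `t`. -/
structure IsFIFO (π : Γ.Profile) (ex : Execution π) : Prop where
  join_start : ∀ i (h : 0 < (π i).val.length), ex.join i ⟨0, h⟩ = Γ.start i
  join_le_enter : ∀ i k, ex.join i k ≤ ex.enter i k
  transit : ∀ i (k : Fin (π i).val.length) (h : k.val + 1 < (π i).val.length),
    ex.join i ⟨k.val + 1, h⟩ = ex.enter i k + Γ.d (edgeAt π i k)
  no_overtake : ∀ j l i k, Ahead π ex j l i k → ex.enter j l ≤ ex.enter i k
  capacity : ∀ (e : Γ.Edge) (t : ℕ),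
    Nat.card {p : Σ i : Fin Γ.n, Fin (π i).val.length //
      edgeAt π p.1 p.2 = e ∧ ex.enter p.1 p.2 = t} ≤ Γ.c e
  eager : ∀ i k (t : ℕ), ex.join i k ≤ t → t < ex.enter i k →
    Γ.c (edgeAt π i k) ≤ Nat.card {p : Σ j : Fin Γ.n, Fin (π j).val.length //
      Ahead π ex p.1 p.2 i k ∧ ex.enter p.1 p.2 = t}

/-- Waiting time of agent `i` in the queue of the `k`-th edge of its path. -/
def waitTime (π : Γ.Profile) (ex : Execution π) (i : Fin Γ.n)
    (k : Fin (π i).val.length) : ℕ :=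
  ex.enter i k - ex.join i k

/-- Total delay of agent `i`: sum over the edges of its path of the waiting
time in the queue plus the fixed delay. -/
def cost (π : Γ.Profile) (ex : Execution π) (i : Fin Γ.n) : ℕ :=
  ∑ k : Fin (π i).val.length, (waitTime π ex i k + Γ.d (edgeAt π i k))

/-- The total delay `C_i(π)` of agent `i` under profile `π` (via the FIFO execution). -/
noncomputable def delay (π : Γ.Profile) (i : Fin Γ.n) : ℕ :=
  sInf {t | ∃ ex : Execution π, IsFIFO π ex ∧ cost π ex i = t}

/-- Pure Nash equilibrium: no agent can strictly decrease its total delay by a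
unilateral deviation to another simple source-sink path. -/
def IsPNE (π : Γ.Profile) : Prop :=
  ∀ (i : Fin Γ.n) (p' : Γ.Strat i), delay π i ≤ delay (Function.update π i p') i

end FROG

namespace FROG

variable {Γ : FROG}

/-- A slot is an agent together with a position on its path. -/
abbrev Slot (π : Γ.Profile) := Σ i : Fin Γ.n, Fin (π i).val.length

/-- The edge traversed at a slot. -/
def slotEdge {π : Γ.Profile} (p : Slot π) : Γ.Edge := edgeAt π p.1 p.2

/-- The rank of a slot in FIFO order: joining time first, then priority. -/
def rank {π : Γ.Profile} (ex : Execution π) (p : Slot π) : ℕ ×ₗ ℕ :=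
  toLex (ex.join p.1 p.2, Γ.prio p.1)

lemma ahead_iff {π : Γ.Profile} (ex : Execution π) (q p : Slot π) :
    Ahead π ex q.1 q.2 p.1 p.2 ↔ slotEdge q = slotEdge p ∧ rank ex q < rank ex p := by
  obtain ⟨j, l⟩ := q
  obtain ⟨i, k⟩ := p
  simp only [Ahead, slotEdge, rank, Prod.Lex.toLex_lt_toLex]
  refine ⟨fun h => ⟨h.1, h.2.2⟩, fun h => ⟨h.1, ?_, h.2⟩⟩
  by_contra! hne
  obtain ⟨rfl, hlk⟩ := hne
  obtain rfl : l = k := Fin.ext hlk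
  omega

lemma IsPathFrom.mem_E {u v : Fin Γ.nV} {p : List Γ.Edge} (h : Γ.IsPathFrom u v p)
    {e : Γ.Edge} (he : e ∈ p) : e ∈ Γ.E := by
  induction p generalizing u with
  | nil => simp at he
  | cons a p ih =>
    rcases List.mem_cons.1 he with rfl | he
    · exact h.2.1
    · exact ih h.2.2 he

lemma slotEdge_mem {π : Γ.Profile} (p : Slot π) : slotEdge p ∈ Γ.E :=
  (π p.1).2.1.mem_E (List.get_mem _ _)

/-- On a simple path, no edge is traversed twice. -/
lemma slot_eq_of_edge_eq {π : Γ.Profile} {q p : Slot π} (hi : q.1 = p.1)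
    (he : slotEdge q = slotEdge p) : q = p := by
  obtain ⟨j, l⟩ := q
  obtain ⟨i, k⟩ := p
  obtain rfl : j = i := hi
  have hnd : (π j).val.Nodup := List.Nodup.of_map _ (List.nodup_cons.1 (π j).2.2).2
  exact congrArg (Sigma.mk j) (List.nodup_iff_injective_get.1 hnd he)

lemma rank_lt_of_le {π : Γ.Profile} {ex : Execution π} {q p : Slot π} (hne : q ≠ p)
    (he : slotEdge q = slotEdge p) (hle : rank ex q ≤ rank ex p) : rank ex q < rank ex p := by
  refine lt_of_le_of_ne hle fun h => hne (slot_eq_of_edge_eq (Γ.prio_inj ?_) he)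
  exact congrArg (fun x => (ofLex x).2) h

/-! ### Uniqueness -/

/-- The position of a slot in the order in which the FIFO dynamics are resolved. -/
def fullRank {π : Γ.Profile} (ex : Execution π) (p : Slot π) : (ℕ ×ₗ ℕ) ×ₗ ℕ :=
  toLex (rank ex p, p.2.val)

/-- Two executions assign the same times to a slot. -/
def Agree {π : Γ.Profile} (ex ex' : Execution π) (p : Slot π) : Prop :=
  ex.join p.1 p.2 = ex'.join p.1 p.2 ∧ ex.enter p.1 p.2 = ex'.enter p.1 p.2

lemma fullRank_pred_lt {π : Γ.Profile} {ex : Execution π} (h : IsFIFO π ex) {i : Fin Γ.n} {k : ℕ}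
    (hk : k + 1 < (π i).val.length) :
    fullRank ex ⟨i, ⟨k, by omega⟩⟩ < fullRank ex ⟨i, ⟨k + 1, hk⟩⟩ := by
  have h₁ := h.join_le_enter i ⟨k, by omega⟩
  have h₂ := h.transit i ⟨k, by omega⟩ hk
  simp only [fullRank, rank, Prod.Lex.toLex_lt_toLex, toLex_inj, Prod.mk.injEq,
    and_true]
  simp only at h₂
  omega

/-- If all slots ahead of `p` agree and `p` has the same joining time in both executions, then `p`
does not enter strictly earlier in the first one. -/
lemma enter_le_of_ahead_agree {π : Γ.Profile} {ex ex' : Execution π} (h : IsFIFO π ex)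
    (h' : IsFIFO π ex') {p : Slot π} (hj : ex.join p.1 p.2 = ex'.join p.1 p.2)
    (hA : ∀ q : Slot π, Ahead π ex' q.1 q.2 p.1 p.2 → Agree ex ex' q) :
    ex'.enter p.1 p.2 ≤ ex.enter p.1 p.2 := by
  by_contra! hlt
  have hle := h'.eager p.1 p.2 _ (hj ▸ h.join_le_enter p.1 p.2) hlt
  have hcap := h.capacity (slotEdge p) (ex.enter p.1 p.2)
  refine absurd (hle.trans_lt ?_) hcap.not_gt
  refine Set.ncard_lt_ncard (s := {q : Slot π | _}) (t := {q : Slot π | _}) ?_ (Set.toFinite _)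
  refine ⟨fun q hq => ⟨hq.1.1, (hA q hq.1).2.trans hq.2⟩, fun hsub => ?_⟩
  have hp := hsub (show p ∈ {q : Slot π | _} from ⟨rfl, rfl⟩)
  exact lt_irrefl _ ((ahead_iff ex' p p).1 hp.1).2

lemma agree_of_fullRank_lt {π : Γ.Profile} {ex ex' : Execution π} (h : IsFIFO π ex)
    (h' : IsFIFO π ex') {p : Slot π}
    (ih : ∀ q, fullRank ex q < fullRank ex p ∨ fullRank ex' q < fullRank ex p → Agree ex ex' q) :
    Agree ex ex' p := by
  have hj : ex.join p.1 p.2 = ex'.join p.1 p.2 := by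
    obtain ⟨i, ⟨k, hk⟩⟩ := p
    cases k with
    | zero => exact (h.join_start i hk).trans (h'.join_start i hk).symm
    | succ k =>
      have hpred := ih _ (Or.inl (fullRank_pred_lt h hk))
      have := h.transit i ⟨k, by omega⟩ hk
      have := h'.transit i ⟨k, by omega⟩ hk
      have := hpred.2
      simp_all only
  have hr : rank ex' p = rank ex p := by simp only [rank, hj]
  have hA' : ∀ q : Slot π, Ahead π ex' q.1 q.2 p.1 p.2 → Agree ex ex' q := fun q hq =>
    ih q (Or.inr (Prod.Lex.toLex_lt_toLex.2 (Or.inl (hr ▸ ((ahead_iff ex' q p).1 hq).2))))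
  have hA : ∀ q : Slot π, Ahead π ex q.1 q.2 p.1 p.2 → Agree ex' ex q := fun q hq =>
    (ih q (Or.inl (Prod.Lex.toLex_lt_toLex.2 (Or.inl ((ahead_iff ex q p).1 hq).2)))).imp
      Eq.symm Eq.symm
  exact ⟨hj, le_antisymm (enter_le_of_ahead_agree h' h hj.symm hA)
    (enter_le_of_ahead_agree h h' hj hA')⟩

theorem IsFIFO.unique {π : Γ.Profile} {ex ex' : Execution π} (h : IsFIFO π ex)
    (h' : IsFIFO π ex') : ex = ex' := by
  have key : ∀ r, ∀ p, fullRank ex p = r ∨ fullRank ex' p = r → Agree ex ex' p := by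
    intro r
    induction r using WellFoundedLT.induction with
    | ind r ih =>
      rintro p (rfl | rfl)
      · exact agree_of_fullRank_lt h h' fun q hq => hq.elim (fun hq => ih _ hq q (Or.inl rfl))
          fun hq => ih _ hq q (Or.inr rfl)
      · refine (agree_of_fullRank_lt h' h fun q hq => ?_).imp Eq.symm Eq.symm
        exact (hq.elim (fun hq => ih _ hq q (Or.inr rfl))
          fun hq => ih _ hq q (Or.inl rfl)).imp Eq.symm Eq.symm
  obtain ⟨j, e⟩ := ex
  obtain ⟨j', e'⟩ := ex'
  congr 1
  · funext i k
    exact (key _ ⟨i, k⟩ (Or.inl rfl)).1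
  · funext i k
    exact (key _ ⟨i, k⟩ (Or.inl rfl)).2

/-! ### Existence -/

/-- The joining times determined by given entering times. -/
def joinOf {π : Γ.Profile} (enter : Slot π → ℕ) : ∀ i : Fin Γ.n, Fin (π i).val.length → ℕ
  | i, ⟨0, _⟩ => Γ.start i
  | i, ⟨k + 1, hk⟩ => enter ⟨i, ⟨k, by omega⟩⟩ + Γ.d (edgeAt π i ⟨k, by omega⟩)

/-- The execution determined by given entering times. -/
def ofEnter {π : Γ.Profile} (enter : Slot π → ℕ) : Execution π where
  join := joinOf enter
  enter i k := enter ⟨i, k⟩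

lemma join_ofEnter_succ {π : Γ.Profile} (enter : Slot π → ℕ) (q : Slot π)
    {l : Fin (π q.1).val.length} (hl : l.val + 1 = q.2.val) :
    (ofEnter enter).join q.1 q.2 = enter ⟨q.1, l⟩ + Γ.d (slotEdge (⟨q.1, l⟩ : Slot π)) := by
  obtain ⟨i, ⟨k, hk⟩⟩ := q
  obtain ⟨l, hl'⟩ := l
  obtain rfl : k = l + 1 := hl.symm
  rfl

/-- The slot preceding `p` on the path of its agent, if any, belongs to `S`. -/
def Ready {π : Γ.Profile} (S : Set (Slot π)) (p : Slot π) : Prop :=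
  ∀ l : Fin (π p.1).val.length, l.val + 1 = p.2.val → (⟨p.1, l⟩ : Slot π) ∈ S

lemma rank_ofEnter_congr {π : Γ.Profile} {S : Set (Slot π)} {enter enter' : Slot π → ℕ}
    (heq : ∀ q ∈ S, enter q = enter' q) {p : Slot π} (hp : Ready S p) :
    rank (ofEnter enter) p = rank (ofEnter enter') p := by
  obtain ⟨i, ⟨k, hk⟩⟩ := p
  cases k with
  | zero => rfl
  | succ k =>
    have := heq _ (hp ⟨k, Nat.lt_of_succ_lt hk⟩ rfl)
    simp only [rank, ofEnter, joinOf] at this ⊢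
    rw [this]

/-- The FIFO rules hold for the slots in `S`, and `S` is an initial segment of the order in which
slots join their queues. -/
structure PartialFIFO {π : Γ.Profile} (S : Set (Slot π)) (enter : Slot π → ℕ) : Prop where
  ready : ∀ p ∈ S, Ready S p
  join_le_enter : ∀ p ∈ S, (rank (ofEnter enter) p).1 ≤ enter p
  rank_le : ∀ q ∈ S, ∀ p ∉ S, Ready S p → rank (ofEnter enter) q ≤ rank (ofEnter enter) p
  no_overtake : ∀ q ∈ S, ∀ p ∈ S, slotEdge q = slotEdge p →
    rank (ofEnter enter) q < rank (ofEnter enter) p → enter q ≤ enter p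
  capacity : ∀ e t, {p | p ∈ S ∧ slotEdge p = e ∧ enter p = t}.ncard ≤ Γ.c e
  eager : ∀ p ∈ S, ∀ t, (rank (ofEnter enter) p).1 ≤ t → t < enter p →
    Γ.c (slotEdge p) ≤ {q | q ∈ S ∧ slotEdge q = slotEdge p ∧
      rank (ofEnter enter) q < rank (ofEnter enter) p ∧ enter q = t}.ncard

lemma exists_ready {π : Γ.Profile} {S : Set (Slot π)} (hS : S ≠ Set.univ) (enter : Slot π → ℕ) :
    ∃ p ∉ S, Ready S p ∧ ∀ q ∉ S, Ready S q → rank (ofEnter enter) p ≤ rank (ofEnter enter) q := by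
  obtain ⟨x, hx⟩ := (Set.ne_univ_iff_exists_notMem S).1 hS
  obtain ⟨y, hy, hmin⟩ := Set.exists_min_image Sᶜ (fun p : Slot π => p.2.val)
    (Set.toFinite _) ⟨x, hx⟩
  have hready : Ready S y := by
    intro l hl
    by_contra hmem
    have := hmin _ hmem
    simp only at this
    omega
  obtain ⟨p, hp, hpmin⟩ := Set.exists_min_image {p | p ∉ S ∧ Ready S p} (rank (ofEnter enter))
    (Set.toFinite _) ⟨y, hy, hready⟩
  exact ⟨p, hp.1, hp.2, fun q hq hq' => hpmin q ⟨hq, hq'⟩⟩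

/-- Some time step from `s` on leaves spare capacity on the edge of `p`. -/
lemma exists_spare_capacity {π : Γ.Profile} (S : Set (Slot π)) (enter : Slot π → ℕ) (p : Slot π)
    (s : ℕ) : ∃ t, s ≤ t ∧
      {q | q ∈ S ∧ slotEdge q = slotEdge p ∧ enter q = t}.ncard < Γ.c (slotEdge p) := by
  obtain ⟨M, hM⟩ := (Set.finite_range enter).bddAbove
  refine ⟨max s (M + 1), le_max_left _ _, ?_⟩
  have hempty : {q | q ∈ S ∧ slotEdge q = slotEdge p ∧ enter q = max s (M + 1)} = ∅ := by
    refine Set.eq_empty_of_forall_notMem fun q hq => ?_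
    have h₁ := hM ⟨q, rfl⟩
    have h₂ := hq.2.2
    omega
  rw [hempty, Set.ncard_empty]
  exact Γ.c_pos _ (slotEdge_mem p)

open Classical in
/-- Scheduling the next slot in joining order as early as its edge allows. -/
lemma PartialFIFO.schedule {π : Γ.Profile} {S : Set (Slot π)} {enter : Slot π → ℕ}
    (h : PartialFIFO S enter) {p : Slot π} (hpS : p ∉ S) (hready : Ready S p)
    (hmin : ∀ q ∉ S, Ready S q → rank (ofEnter enter) p ≤ rank (ofEnter enter) q) :
    ∃ t, PartialFIFO (insert p S) (Function.update enter p t) := by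
  have hex := exists_spare_capacity S enter p (rank (ofEnter enter) p).1
  obtain ⟨t, ⟨htj, htc⟩, htmin⟩ : ∃ t, ((rank (ofEnter enter) p).1 ≤ t ∧
      {q | q ∈ S ∧ slotEdge q = slotEdge p ∧ enter q = t}.ncard < Γ.c (slotEdge p)) ∧
      ∀ s < t, (rank (ofEnter enter) p).1 ≤ s → Γ.c (slotEdge p) ≤
        {q | q ∈ S ∧ slotEdge q = slotEdge p ∧ enter q = s}.ncard :=
    ⟨Nat.find hex, Nat.find_spec hex, fun s hs hjs =>
      not_lt.1 fun hlt => Nat.find_min hex hs ⟨hjs, hlt⟩⟩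
  refine ⟨t, ?_⟩
  set enter' := Function.update enter p t
  have hp : enter' p = t := Function.update_self ..
  have hne : ∀ q ∈ S, q ≠ p := fun q hq hqp => hpS (hqp ▸ hq)
  have hS : ∀ q ∈ S, enter q = enter' q := fun q hq => (Function.update_of_ne (hne q hq) ..).symm
  have hrank : ∀ q, Ready S q → rank (ofEnter enter') q = rank (ofEnter enter) q :=
    fun q hq => (rank_ofEnter_congr hS hq).symm
  have hrp := hrank p hready
  have hrS : ∀ q ∈ S, rank (ofEnter enter') q = rank (ofEnter enter) q :=
    fun q hq => hrank q (h.ready q hq)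
  have hle : ∀ q ∈ S, rank (ofEnter enter) q ≤ rank (ofEnter enter) p :=
    fun q hq => h.rank_le q hq p hpS hready
  have hlt : ∀ q ∈ S, slotEdge q = slotEdge p → rank (ofEnter enter) q < rank (ofEnter enter) p :=
    fun q hq he => rank_lt_of_le (hne q hq) he (hle q hq)
  refine ⟨?_, ?_, ?_, ?_, ?_, ?_⟩
  · rintro q (rfl | hq) l hl
    · exact Or.inr (hready l hl)
    · exact Or.inr (h.ready q hq l hl)
  · rintro q (rfl | hq)
    · rw [hrp, hp]; exact htj
    · rw [hrS q hq, ← hS q hq]; exact h.join_le_enter q hq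
  · intro r hr q hq hqr
    have hqS : q ∉ S := fun hmem => hq (Or.inr hmem)
    have hrle : rank (ofEnter enter') r ≤ rank (ofEnter enter) p := by
      rcases hr with rfl | hr
      · exact hrp.le
      · rw [hrS r hr]; exact hle r hr
    refine hrle.trans ?_
    by_cases hqS' : Ready S q
    · rw [hrank q hqS']; exact hmin q hqS hqS'
    · obtain ⟨l, hl, hlS⟩ : ∃ l : Fin (π q.1).val.length, l.val + 1 = q.2.val ∧
          (⟨q.1, l⟩ : Slot π) ∉ S := by
        simpa only [Ready, not_forall, exists_prop] using hqS'
      have hlp : (⟨q.1, l⟩ : Slot π) = p := (hqr l hl).resolve_right hlS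
      have hjoin := join_ofEnter_succ enter' q hl
      rw [hlp, hp] at hjoin
      have hj : (ofEnter enter).join p.1 p.2 ≤ t := htj
      have hi : Γ.prio p.1 = Γ.prio q.1 := by rw [← hlp]
      simp only [rank, Prod.Lex.toLex_le_toLex, hjoin, hi]
      omega
  · rintro q (rfl | hq) r (rfl | hr) he hqr
    · rfl
    · rw [hrp, hrS r hr] at hqr
      exact absurd hqr (hle r hr).not_gt
    · rw [hp, ← hS q hq]
      by_contra! htq
      have hqj : (rank (ofEnter enter) q).1 ≤ t := (Prod.Lex.monotone_fst _ _ (hle q hq)).trans htj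
      refine absurd ((he ▸ h.eager q hq t hqj htq).trans (Set.ncard_le_ncard ?_ (Set.toFinite _)))
        htc.not_ge
      exact fun x hx => ⟨hx.1, hx.2.1, hx.2.2.2⟩
    · rw [hrS q hq, hrS r hr] at hqr
      rw [← hS q hq, ← hS r hr]
      exact h.no_overtake q hq r hr he hqr
  · intro e s
    have hsub : {q | q ∈ insert p S ∧ slotEdge q = e ∧ enter' q = s} ⊆
        insert p {q | q ∈ S ∧ slotEdge q = e ∧ enter q = s} := by
      rintro q ⟨rfl | hq, he, hs⟩
      · exact Or.inl rfl
      · exact Or.inr ⟨hq, he, (hS q hq).trans hs⟩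
    by_cases hps : slotEdge p = e ∧ t = s
    · obtain ⟨rfl, rfl⟩ := hps
      exact (Set.ncard_le_ncard hsub (Set.toFinite _)).trans ((Set.ncard_insert_le _ _).trans htc)
    · refine (Set.ncard_le_ncard ?_ (Set.toFinite _)).trans (h.capacity e s)
      intro q hq
      refine (hsub hq).resolve_left ?_
      rintro rfl
      exact hps ⟨hq.2.1, hp.symm.trans hq.2.2⟩
  · rintro q (rfl | hq) s hjs hs
    · rw [hrp] at hjs
      rw [hp] at hs
      refine (htmin s hs hjs).trans (Set.ncard_le_ncard ?_ (Set.toFinite _))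
      intro x hx
      refine ⟨Or.inr hx.1, hx.2.1, ?_, (hS x hx.1).symm.trans hx.2.2⟩
      rw [hrp, hrS x hx.1]
      exact hlt x hx.1 hx.2.1
    · rw [hrS q hq] at hjs
      rw [← hS q hq] at hs
      refine (h.eager q hq s hjs hs).trans (Set.ncard_le_ncard ?_ (Set.toFinite _))
      intro x hx
      refine ⟨Or.inr hx.1, hx.2.1, ?_, (hS x hx.1).symm.trans hx.2.2.2⟩
      rw [hrS q hq, hrS x hx.1]
      exact hx.2.2.1

lemma PartialFIFO.empty {π : Γ.Profile} (enter : Slot π → ℕ) : PartialFIFO ∅ enter := by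
  constructor <;> simp

lemma exists_partialFIFO_univ (π : Γ.Profile) :
    ∃ enter : Slot π → ℕ, PartialFIFO Set.univ enter := by
  obtain ⟨S, ⟨enter, h⟩, hmax⟩ := Set.exists_max_image
    {S : Set (Slot π) | ∃ enter, PartialFIFO S enter} Set.ncard (Set.toFinite _) ⟨∅, fun _ => 0, PartialFIFO.empty _⟩
  by_cases hS : S = Set.univ
  · exact ⟨enter, hS ▸ h⟩
  obtain ⟨p, hpS, hready, hmin⟩ := exists_ready hS enter
  obtain ⟨t, ht⟩ := h.schedule hpS hready hmin
  have := hmax _ ⟨_, ht⟩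
  rw [Set.ncard_insert_of_notMem hpS (Set.toFinite _)] at this
  omega

lemma PartialFIFO.isFIFO {π : Γ.Profile} {enter : Slot π → ℕ} (h : PartialFIFO Set.univ enter) :
    IsFIFO π (ofEnter enter) where
  join_start _ _ := rfl
  join_le_enter i k := h.join_le_enter ⟨i, k⟩ trivial
  transit _ _ _ := rfl
  no_overtake j l i k hA :=
    have hA := (ahead_iff (ofEnter enter) ⟨j, l⟩ ⟨i, k⟩).1 hA
    h.no_overtake ⟨j, l⟩ trivial ⟨i, k⟩ trivial hA.1 hA.2
  capacity e t := by
    refine le_trans (Set.ncard_le_ncard (s := {p : Slot π | _}) ?_ (Set.toFinite _))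
      (h.capacity e t)
    exact fun p hp => ⟨trivial, hp⟩
  eager i k t hj ht := by
    refine (h.eager ⟨i, k⟩ trivial t hj ht).trans
      (Set.ncard_le_ncard (t := {p : Slot π | _}) ?_ (Set.toFinite _))
    exact fun p hp => ⟨(ahead_iff (ofEnter enter) p ⟨i, k⟩).2 ⟨hp.2.1, hp.2.2.1⟩, hp.2.2.2⟩

end FROG

/-- For every FROG and every strategy profile, the FIFO
dynamics determine a unique execution: there is a unique assignment of queue
joining times and edge entering times satisfying the FIFO rules (so every
agent reaches its sink after finitely many time steps), and consequently the
vector of total delays `(C_1(π), …, C_n(π)) ∈ ℕⁿ` is well defined. -/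
theorem frog_delays_well_defined (Γ : FROG) (π : Γ.Profile) :
    (∃! ex : FROG.Execution π, FROG.IsFIFO π ex) ∧
    (∃! C : Fin Γ.n → ℕ,
      ∃ ex : FROG.Execution π, FROG.IsFIFO π ex ∧ C = FROG.cost π ex) := by
  obtain ⟨enter, h⟩ := FROG.exists_partialFIFO_univ π
  refine ⟨⟨_, h.isFIFO, fun _ h' => h'.unique h.isFIFO⟩, _, ⟨_, h.isFIFO, rfl⟩, ?_⟩
  rintro _ ⟨_, h', rfl⟩
  rw [h'.unique h.isFIFO]
end

section
/- In the filter gadget with parameter M ≥ 1, the agent y crosses the chain u_0 → u_1 → ⋯ → u_M with zero waiting time (arriving at u_M at time 0), whereas the agent x is delayed by at least M time steps before reaching u_M: x waits one time step on each edge (u_{i−1}, u_i). Moreover the filter gadget contains Θ(M) vertices and Θ(M²) agents. -/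
namespace FROG

variable {Γ : FROG}

/-- The edges joining consecutive vertices of a sequence form a directed path. -/
theorem isPathFrom_ofFn (Γ : FROG) {m : ℕ} (v : Fin (m + 1) → Fin Γ.nV)
    (hv : ∀ i : Fin m, (v i.castSucc, v i.succ) ∈ Γ.E) :
    Γ.IsPathFrom (v 0) (v (Fin.last m)) (List.ofFn fun i : Fin m => (v i.castSucc, v i.succ)) := by
  induction m with
  | zero => rfl
  | succ m ih =>
    rw [List.ofFn_succ]
    exact ⟨rfl, hv 0, ih (fun i => v i.succ) fun i => hv i.succ⟩

/-- The path along a sequence of distinct vertices is simple. -/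
theorem isSimple_ofFn (Γ : FROG) {m : ℕ} (v : Fin (m + 1) → Fin Γ.nV)
    (hv : Function.Injective v) :
    Γ.IsSimple (v 0) (List.ofFn fun i : Fin m => (v i.castSucc, v i.succ)) := by
  have h : v 0 :: (List.ofFn fun i : Fin m => (v i.castSucc, v i.succ)).map Prod.snd
      = List.ofFn v := by
    rw [List.ofFn_succ, List.map_ofFn]
    rfl
  rw [IsSimple, h]
  exact List.nodup_ofFn.2 hv

/-- On an edge of capacity `1`, agents entering at the same time coincide. -/
theorem IsFIFO.eq_of_enter_eq {π : Γ.Profile} {ex : Execution π} (h : IsFIFO π ex)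
    {i j : Fin Γ.n} {k : Fin (π i).val.length} {l : Fin (π j).val.length}
    (hc : Γ.c (edgeAt π i k) = 1) (he : edgeAt π j l = edgeAt π i k)
    (ht : ex.enter j l = ex.enter i k) : j = i := by
  have hcard := hc ▸ h.capacity (edgeAt π i k) (ex.enter i k)
  have := Finite.card_le_one_iff_subsingleton.1 hcard
  have := Subsingleton.elim
    (⟨⟨j, l⟩, he, ht⟩ : {p : Σ i : Fin Γ.n, Fin (π i).val.length //
      edgeAt π p.1 p.2 = edgeAt π i k ∧ ex.enter p.1 p.2 = ex.enter i k}) ⟨⟨i, k⟩, rfl, rfl⟩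
  exact congrArg (fun p => p.1.1) this

/-- An agent still waiting at time `t` is preceded by an agent entering at time `t`. -/
theorem IsFIFO.exists_ahead {π : Γ.Profile} {ex : Execution π} (h : IsFIFO π ex)
    {i : Fin Γ.n} {k : Fin (π i).val.length} {t : ℕ} (hc : 1 ≤ Γ.c (edgeAt π i k))
    (hj : ex.join i k ≤ t) (ht : t < ex.enter i k) :
    ∃ j l, Ahead π ex j l i k ∧ ex.enter j l = t := by
  have hpos := hc.trans (h.eager i k t hj ht)
  obtain ⟨⟨⟨j, l⟩, hp⟩⟩ := (Nat.card_pos_iff.1 hpos).1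
  exact ⟨j, l, hp⟩

end FROG

namespace FilterGadget

open FROG

variable {M : ℕ}

/-- The chain vertex `u_i`. -/
def chainVertex (i : Fin (M + 1)) : Fin (3 * M + 1) := ⟨i, by omega⟩

/-- The source of the blockers of the `i`-th chain edge. -/
def blockerSource (i : Fin M) : Fin (3 * M + 1) := ⟨M + 1 + i, by omega⟩

/-- The sink of the blockers of the `i`-th chain edge. -/
def blockerSink (i : Fin M) : Fin (3 * M + 1) := ⟨2 * M + 1 + i, by omega⟩

/-- The `i`-th edge of the chain. -/
def chainEdge (i : Fin M) : Fin (3 * M + 1) × Fin (3 * M + 1) :=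
  (chainVertex i.castSucc, chainVertex i.succ)

/-- The edge leading the blockers to the tail of the `i`-th chain edge. -/
def feedEdge (i : Fin M) : Fin (3 * M + 1) × Fin (3 * M + 1) :=
  (blockerSource i, chainVertex i.castSucc)

/-- The edge leading the blockers from the head of the `i`-th chain edge to their sink. -/
def exitEdge (i : Fin M) : Fin (3 * M + 1) × Fin (3 * M + 1) :=
  (chainVertex i.succ, blockerSink i)

theorem chainEdge_inj {i j : Fin M} : chainEdge i = chainEdge j ↔ i = j := by
  simp [chainEdge, chainVertex, Fin.ext_iff]

theorem feedEdge_inj {i j : Fin M} : feedEdge i = feedEdge j ↔ i = j := by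
  simp [feedEdge, blockerSource, chainVertex, Fin.ext_iff]

theorem feedEdge_ne_chainEdge (i j : Fin M) : feedEdge i ≠ chainEdge j := by
  simp only [feedEdge, chainEdge, blockerSource, chainVertex, Fin.val_castSucc, Fin.val_succ, ne_eq,
    Prod.mk.injEq, Fin.mk.injEq]
  omega

theorem exitEdge_ne_chainEdge (i j : Fin M) : exitEdge i ≠ chainEdge j := by
  simp only [exitEdge, chainEdge, blockerSink, chainVertex, Fin.val_castSucc, Fin.val_succ, ne_eq,
    Prod.mk.injEq, Fin.mk.injEq]
  omega

theorem exitEdge_ne_feedEdge (i j : Fin M) : exitEdge i ≠ feedEdge j := by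
  simp only [exitEdge, feedEdge, blockerSink, blockerSource, chainVertex, Fin.val_castSucc,
    Fin.val_succ, ne_eq, Prod.mk.injEq, Fin.mk.injEq]
  omega

/-- The agents of the gadget: `y`, `x`, and for each chain edge `i` and each starting time `t`
a blocker. -/
inductive Agent (M : ℕ)
  | y
  | x
  | blocker (i t : Fin M)

/-- The agents listed by decreasing priority: `y`, then the blockers, then `x`. -/
def role : Fin (M * M + 2) → Agent M :=
  Fin.cases .y (Fin.lastCases .x fun q =>
    .blocker (finProdFinEquiv.symm q).1 (finProdFinEquiv.symm q).2)

/-- The position of an agent in the list. -/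
def index : Agent M → Fin (M * M + 2)
  | .y => 0
  | .x => Fin.last _
  | .blocker i t => (finProdFinEquiv (i, t)).castSucc.succ

theorem role_index (r : Agent M) : role (index r) = r := by
  cases r with
  | y => rfl
  | x => rw [role, index, ← Fin.succ_last, Fin.cases_succ, Fin.lastCases_last]
  | blocker i t =>
    rw [role, index, Fin.cases_succ, Fin.lastCases_castSucc, Equiv.symm_apply_apply]

theorem index_role (a : Fin (M * M + 2)) : index (role a) = a := by
  induction a using Fin.cases with
  | zero => rfl
  | succ a =>
    induction a using Fin.lastCases with
    | last => rw [role, Fin.cases_succ, Fin.lastCases_last, index, Fin.succ_last]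
    | cast q =>
      rw [role, Fin.cases_succ, Fin.lastCases_castSucc, index, Prod.mk.eta,
        Equiv.apply_symm_apply]

theorem role_injective : Function.Injective (role (M := M)) :=
  Function.LeftInverse.injective index_role

theorem le_of_role_eq_x {a b : Fin (M * M + 2)} (h : role a = .x) : b.val ≤ a.val := by
  rw [← index_role a, h]
  exact Fin.le_last b

theorem val_of_role_eq_y {a : Fin (M * M + 2)} (h : role a = .y) : a.val = 0 := by
  rw [← index_role a, h]
  rfl

namespace Agent

/-- The source of an agent. -/
def src : Agent M → Fin (3 * M + 1)
  | .y | .x => chainVertex 0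
  | .blocker i _ => blockerSource i

/-- The sink of an agent. -/
def sink : Agent M → Fin (3 * M + 1)
  | .y | .x => chainVertex (Fin.last M)
  | .blocker i _ => blockerSink i

/-- The starting time of an agent. -/
def start : Agent M → ℕ
  | .y | .x => 0
  | .blocker _ t => t

/-- The path of an agent. -/
def path : Agent M → List (Fin (3 * M + 1) × Fin (3 * M + 1))
  | .y | .x => List.ofFn chainEdge
  | .blocker i _ => [feedEdge i, chainEdge i, exitEdge i]

theorem get_path_eq_chainEdge {r : Agent M} {k : Fin r.path.length} {i : Fin M}
    (h : r.path.get k = chainEdge i) :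
    (r = .y ∨ r = .x) ∧ k.val = i ∨ ∃ t, r = .blocker i t ∧ k.val = 1 := by
  match r, k, h with
  | .y, k, h | .x, k, h =>
    have hi : k.cast (List.length_ofFn (f := chainEdge)) = i :=
      chainEdge_inj.1 ((List.get_ofFn chainEdge k).symm.trans h)
    exact .inl ⟨by simp, congrArg Fin.val hi⟩
  | .blocker j t, ⟨0, _⟩, h => exact absurd h (feedEdge_ne_chainEdge j i)
  | .blocker j t, ⟨1, _⟩, h =>
    obtain rfl : j = i := chainEdge_inj.1 h
    exact .inr ⟨t, rfl, rfl⟩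
  | .blocker j t, ⟨2, _⟩, h => exact absurd h (exitEdge_ne_chainEdge j i)

theorem get_path_eq_feedEdge {r : Agent M} {k : Fin r.path.length} {i : Fin M}
    (h : r.path.get k = feedEdge i) : ∃ t, r = .blocker i t ∧ k.val = 0 := by
  match r, k, h with
  | .y, k, h | .x, k, h =>
    exact absurd (h.symm.trans (List.get_ofFn chainEdge k)) (feedEdge_ne_chainEdge _ _)
  | .blocker j t, ⟨0, _⟩, h =>
    obtain rfl : j = i := feedEdge_inj.1 h
    exact ⟨t, rfl, rfl⟩
  | .blocker j t, ⟨1, _⟩, h => exact absurd h.symm (feedEdge_ne_chainEdge i j)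
  | .blocker j t, ⟨2, _⟩, h => exact absurd h (exitEdge_ne_feedEdge j i)

theorem exists_get_path_eq_chainEdge {r : Agent M} (hr : r = .y ∨ r = .x)
    (k : Fin r.path.length) : ∃ i : Fin M, i.val = k.val ∧ r.path.get k = chainEdge i := by
  rcases hr with rfl | rfl <;>
  exact ⟨k.cast (List.length_ofFn (f := chainEdge)), rfl, List.get_ofFn chainEdge k⟩

theorem get_path_of_eq_blocker {r : Agent M} {i t : Fin M} (hr : r = .blocker i t)
    (k : Fin r.path.length) :
    (k.val = 0 → r.path.get k = feedEdge i) ∧ (k.val = 1 → r.path.get k = chainEdge i) := by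
  subst hr
  obtain ⟨k, _⟩ := k
  constructor <;>
  · rintro rfl
    rfl

end Agent

/-- The filter gadget. All capacities are `1`. The edges leaving the sources of the blockers have
fixed delay `1`, so that the blocker starting at time `t` reaches the chain at time `t + 1`; all
other edges have fixed delay `0`. -/
def gadget (M : ℕ) : FROG where
  nV := 3 * M + 1
  E := Finset.univ.image chainEdge ∪ Finset.univ.image feedEdge ∪ Finset.univ.image exitEdge
  c _ := 1
  d e := if M < e.1.val then 1 else 0
  n := M * M + 2
  src a := (role a).src
  sink a := (role a).sink
  start a := (role a).start
  prio a := a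
  prio_inj := Fin.val_injective
  c_pos _ _ := le_rfl

theorem isPathFrom_path (r : Agent M) : (gadget M).IsPathFrom r.src r.sink r.path := by
  have hchain (i : Fin M) : chainEdge i ∈ (gadget M).E :=
    Finset.mem_union_left _ (Finset.mem_union_left _ (Finset.mem_image_of_mem _ (Finset.mem_univ i)))
  have hfeed (i : Fin M) : feedEdge i ∈ (gadget M).E :=
    Finset.mem_union_left _ (Finset.mem_union_right _ (Finset.mem_image_of_mem _ (Finset.mem_univ i)))
  have hexit (i : Fin M) : exitEdge i ∈ (gadget M).E :=
    Finset.mem_union_right _ (Finset.mem_image_of_mem _ (Finset.mem_univ i))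
  match r with
  | .y | .x => exact isPathFrom_ofFn (gadget M) chainVertex hchain
  | .blocker i _ => exact ⟨rfl, hfeed i, rfl, hchain i, rfl, hexit i, rfl⟩

theorem isSimple_path (r : Agent M) : (gadget M).IsSimple r.src r.path := by
  match r with
  | .y | .x =>
    exact isSimple_ofFn (gadget M) chainVertex fun i j h => Fin.ext (Fin.mk.inj h)
  | .blocker i _ =>
    change [blockerSource i, chainVertex i.castSucc, chainVertex i.succ, blockerSink i].Nodup
    simp only [blockerSource, chainVertex, blockerSink, Fin.val_castSucc, Fin.val_succ,
      List.nodup_cons, List.mem_cons, List.not_mem_nil, List.nodup_nil, Fin.mk.injEq]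
    simp only [or_false, not_false_eq_true, and_true]
    omega

/-- The profile in which every agent follows its path. -/
def profile (M : ℕ) : (gadget M).Profile := fun a =>
  ⟨(role a).path, isPathFrom_path _, isSimple_path _⟩

theorem profile_x_eq_profile_y (M : ℕ) :
    (profile M (index .x)).val = (profile M (index .y)).val :=
  (congrArg Agent.path (role_index .x)).trans (congrArg Agent.path (role_index .y)).symm

theorem length_profile_x (M : ℕ) : (profile M (index .x)).val.length = M :=
  (congrArg (fun r : Agent M => r.path.length) (role_index .x)).trans List.length_ofFn

theorem d_chainEdge (i : Fin M) : (gadget M).d (chainEdge i) = 0 :=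
  if_neg (by simp [chainEdge, chainVertex])

theorem d_feedEdge (i : Fin M) : (gadget M).d (feedEdge i) = 1 :=
  if_pos (by simp only [feedEdge, blockerSource]; omega)

theorem edgeAt_of_role_eq_y_or_x {a : Fin (gadget M).n} (ha : role a = .y ∨ role a = .x)
    (k : Fin (profile M a).val.length) :
    ∃ i : Fin M, i.val = k.val ∧ edgeAt (profile M) a k = chainEdge i :=
  Agent.exists_get_path_eq_chainEdge ha k

theorem edgeAt_of_role_eq_blocker {a : Fin (gadget M).n} {i t : Fin M}
    (ha : role a = .blocker i t) (k : Fin (profile M a).val.length) :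
    (k.val = 0 → edgeAt (profile M) a k = feedEdge i) ∧
      (k.val = 1 → edgeAt (profile M) a k = chainEdge i) :=
  Agent.get_path_of_eq_blocker ha k

/-- The agent `y` joins and enters every edge of the chain at time `0`. -/
theorem times_y {ex : Execution (profile M)} (h : IsFIFO (profile M) ex)
    {a : Fin (gadget M).n} (ha : role a = .y) (k : Fin (profile M a).val.length) :
    ex.join a k = 0 ∧ ex.enter a k = 0 := by
  have enter_eq (k : Fin (profile M a).val.length) (hjoin : ex.join a k = 0) :
      ex.enter a k = 0 := by
    refine Nat.eq_zero_of_not_pos fun hpos => ?_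
    obtain ⟨j, l, ⟨-, -, hahead⟩, -⟩ := h.exists_ahead le_rfl hjoin.le hpos
    have hprio : (gadget M).prio a = 0 := val_of_role_eq_y ha
    omega
  suffices hjoin : ex.join a k = 0 from ⟨hjoin, enter_eq k hjoin⟩
  obtain ⟨k, hk⟩ := k
  induction k with
  | zero => exact (h.join_start a hk).trans (congrArg Agent.start ha)
  | succ k ih =>
    obtain ⟨i, -, hi⟩ := edgeAt_of_role_eq_y_or_x (.inl ha) ⟨k, by omega⟩
    rw [h.transit a ⟨k, by omega⟩ hk, hi, d_chainEdge, enter_eq _ (ih _)]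

/-- Blockers do not wait on the edge leaving their source. -/
theorem enter_feedEdge {ex : Execution (profile M)} (h : IsFIFO (profile M) ex) {i t : Fin M}
    {a : Fin (gadget M).n} (ha : role a = .blocker i t)
    (k : Fin (profile M a).val.length) (hk : k.val = 0) : ex.enter a k = t := by
  have hjoin {t : Fin M} {a : Fin (gadget M).n} (ha : role a = .blocker i t)
      (k : Fin (profile M a).val.length) (hk : k.val = 0) : ex.join a k = t := by
    obtain ⟨_, hlt⟩ := k
    obtain rfl := hk
    exact (h.join_start a hlt).trans (congrArg Agent.start ha)
  induction t using WellFoundedLT.induction generalizing a with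
  | _ t ih =>
    refine le_antisymm (le_of_not_gt fun hlt => ?_) ((hjoin ha k hk).ge.trans (h.join_le_enter a k))
    obtain ⟨j, l, ⟨he, hne, hahead⟩, hent⟩ := h.exists_ahead le_rfl (hjoin ha k hk).le hlt
    obtain ⟨t', hj, hl⟩ := Agent.get_path_eq_feedEdge (r := role j) (k := l)
      (he.trans ((edgeAt_of_role_eq_blocker ha k).1 hk))
    have htt' : t' ≠ t := by
      rintro rfl
      obtain rfl := role_injective (hj.trans ha.symm)
      exact hne.elim (fun hne => hne rfl) (fun hne => hne (hl.trans hk.symm))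
    rw [hjoin ha k hk, hjoin hj l hl] at hahead
    have hlt' : t' < t := lt_of_le_of_ne (Fin.le_def.2 (by omega)) htt'
    exact htt' (Fin.ext ((ih t' hlt' hj l hl).symm.trans hent))

/-- The blocker starting at time `t` joins its chain edge at time `t + 1`. -/
theorem join_chainEdge_of_blocker {ex : Execution (profile M)} (h : IsFIFO (profile M) ex)
    {i t : Fin M} {a : Fin (gadget M).n} (ha : role a = .blocker i t)
    (k : Fin (profile M a).val.length) (hk : k.val = 1) : ex.join a k = t + 1 := by
  obtain ⟨_, hlt⟩ := k
  obtain rfl := hk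
  have hpos : 0 < (profile M a).val.length := by omega
  rw [h.transit a ⟨0, hpos⟩ hlt, (edgeAt_of_role_eq_blocker ha _).1 rfl, d_feedEdge,
    enter_feedEdge h ha _ rfl]

/-- As long as `x` has not joined the `i`-th chain edge before time `i`, the blockers joining this
edge up to time `i` do not wait. -/
theorem enter_chainEdge_of_blocker {ex : Execution (profile M)} (h : IsFIFO (profile M) ex)
    {i t : Fin M} (hx : ∀ (b : Fin (gadget M).n) (l : Fin (profile M b).val.length),
      role b = .x → l.val = i → i.val ≤ ex.join b l)
    {a : Fin (gadget M).n} (ha : role a = .blocker i t) (hti : t < i)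
    (k : Fin (profile M a).val.length) (hk : k.val = 1) : ex.enter a k = t + 1 := by
  induction t using WellFoundedLT.induction generalizing a with
  | _ t ih =>
    have hjoin := join_chainEdge_of_blocker h ha k hk
    refine le_antisymm (le_of_not_gt fun hlt => ?_) (hjoin.ge.trans (h.join_le_enter a k))
    obtain ⟨j, l, ⟨he, hne, hahead⟩, hent⟩ := h.exists_ahead le_rfl hjoin.le hlt
    rcases Agent.get_path_eq_chainEdge (r := role j) (k := l)
      (he.trans ((edgeAt_of_role_eq_blocker ha k).2 hk)) with ⟨hj | hj, hl⟩ | ⟨t', hj, hl⟩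
    · exact absurd ((times_y h hj l).2.symm.trans hent) (by omega)
    · have hprio : (gadget M).prio a ≤ (gadget M).prio j := le_of_role_eq_x hj
      have := hx j l hj hl
      rw [hjoin] at hahead
      rw [Fin.lt_def] at hti
      omega
    · have htt' : t' ≠ t := by
        rintro rfl
        obtain rfl := role_injective (hj.trans ha.symm)
        exact hne.elim (fun hne => hne rfl) (fun hne => hne (hl.trans hk.symm))
      rw [hjoin, join_chainEdge_of_blocker h hj l hl] at hahead
      have hlt' : t' < t := lt_of_le_of_ne (Fin.le_def.2 (by omega)) htt'
      have := (ih t' hlt' hj (hlt'.trans hti) l hl).symm.trans hent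
      exact htt' (Fin.ext (by omega))

/-- The agent `x` joins the `k`-th edge of the chain at time `k` and enters it at time `k + 1`. -/
theorem times_x {ex : Execution (profile M)} (h : IsFIFO (profile M) ex)
    {a : Fin (gadget M).n} (ha : role a = .x) (k : Fin (profile M a).val.length) :
    ex.join a k = k ∧ ex.enter a k = k + 1 := by
  have enter_eq (k : Fin (profile M a).val.length) (hjoin : ex.join a k = k) :
      ex.enter a k = k + 1 := by
    obtain ⟨i, hik, hi⟩ := edgeAt_of_role_eq_y_or_x (.inr ha) k
    have hx (b : Fin (gadget M).n) (l : Fin (profile M b).val.length) (hb : role b = .x)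
        (hl : l.val = i) : i.val ≤ ex.join b l := by
      obtain rfl := role_injective (hb.trans ha.symm)
      obtain rfl : l = k := Fin.ext (hl.trans hik)
      exact (hik.trans hjoin.symm).le
    have hne : ex.enter a k ≠ k := by
      intro hent
      rcases Nat.eq_zero_or_pos i.val with hi0 | hi0
      · have hy : role (index .y : Fin (M * M + 2)) = .y := role_index _
        have hlen : i.val < (profile M (index .y)).val.length := by
          change i.val < (role (index (.y : Agent M))).path.length
          rw [hy]
          exact i.isLt.trans_eq List.length_ofFn.symm
        obtain ⟨i', hi', he⟩ := edgeAt_of_role_eq_y_or_x (.inl hy) ⟨i, hlen⟩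
        obtain rfl : i' = i := Fin.ext hi'
        have := h.eq_of_enter_eq rfl (he.trans hi.symm)
          ((times_y h hy _).2.trans (hi0.symm.trans (hik.trans hent.symm)))
        rw [← this, hy] at ha
        cases ha
      · let t : Fin M := ⟨i - 1, by omega⟩
        have hb : role (index (.blocker i t) : Fin (M * M + 2)) = .blocker i t := role_index _
        have hlen : 1 < (profile M (index (.blocker i t))).val.length := by
          change 1 < (role (index (.blocker i t))).path.length
          rw [hb]
          exact Nat.lt_succ_of_lt (Nat.lt_succ_self 1)
        have hbent := enter_chainEdge_of_blocker h hx hb (Fin.lt_def.2 (Nat.sub_lt hi0 one_pos))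
          ⟨1, hlen⟩ rfl
        have := h.eq_of_enter_eq rfl (((edgeAt_of_role_eq_blocker hb ⟨1, hlen⟩).2 rfl).trans hi.symm)
          (hbent.trans ((Nat.sub_add_cancel hi0).trans (hik.trans hent.symm)))
        rw [← this, hb] at ha
        cases ha
    have hle := h.join_le_enter a k
    refine le_antisymm (le_of_not_gt fun hlt => ?_) (by omega)
    obtain ⟨j, l, ⟨he, hne, hahead⟩, hent⟩ :=
      h.exists_ahead le_rfl (hjoin.le.trans (Nat.le_succ _)) hlt
    rcases Agent.get_path_eq_chainEdge (r := role j) (k := l) (he.trans hi) with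
      ⟨hj | hj, hl⟩ | ⟨t, hj, hl⟩
    · exact absurd ((times_y h hj l).2.symm.trans hent) (by omega)
    · obtain rfl := role_injective (hj.trans ha.symm)
      exact hne.elim (fun hne => hne rfl) (fun hne => hne (hl.trans hik))
    · have hprio : (gadget M).prio j ≤ (gadget M).prio a := le_of_role_eq_x ha
      rw [hjoin, join_chainEdge_of_blocker h hj l hl] at hahead
      have hti : t < i := Fin.lt_def.2 (by omega)
      have := (enter_chainEdge_of_blocker h hx hj hti l hl).symm.trans hent
      omega
  suffices hjoin : ex.join a k = k from ⟨hjoin, enter_eq k hjoin⟩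
  obtain ⟨k, hk⟩ := k
  induction k with
  | zero => exact (h.join_start a hk).trans (congrArg Agent.start ha)
  | succ k ih =>
    obtain ⟨i, -, hi⟩ := edgeAt_of_role_eq_y_or_x (.inr ha) ⟨k, by omega⟩
    rw [h.transit a ⟨k, by omega⟩ hk, hi, d_chainEdge, enter_eq _ (ih _)]

end FilterGadget

/-- The filter gadget: there is a family of FROGs indexed by
the parameter `M ≥ 1`, with distinguished agents `x` and `y` both entering the
chain `u_0 → u_1 → ⋯ → u_M` (of `M` edges, each of capacity `1` and fixed
delay `0`) at time `0`, such that in the (unique) FIFO execution agent `y`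
crosses the chain with zero waiting time on every edge — hence total delay `0`,
arriving at `u_M` at time `0` — whereas agent `x` waits exactly one time step
on each edge of the chain, hence is delayed by at least `M` time steps before
reaching `u_M`.  Moreover the gadget contains `Θ(M)` vertices and `Θ(M²)`
agents. -/
theorem filter_gadget :
    ∃ (Γ : ℕ → FROG) (x y : ∀ M, Fin (Γ M).n) (π : ∀ M, (Γ M).Profile) (A B : ℕ),
      0 < A ∧
      ∀ M, 1 ≤ M →
        (A * M ≤ (Γ M).nV ∧ (Γ M).nV ≤ B * M ∧
         A * M ^ 2 ≤ (Γ M).n ∧ (Γ M).n ≤ B * M ^ 2) ∧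
        x M ≠ y M ∧
        ((π M) (x M)).val.length = M ∧
        ((π M) (x M)).val = ((π M) (y M)).val ∧
        (∀ e ∈ ((π M) (x M)).val, (Γ M).c e = 1 ∧ (Γ M).d e = 0) ∧
        (Γ M).start (x M) = 0 ∧ (Γ M).start (y M) = 0 ∧
        ∀ ex : FROG.Execution (π M), FROG.IsFIFO (π M) ex →
          (∀ k, FROG.waitTime (π M) ex (y M) k = 0) ∧
          (∀ k, FROG.waitTime (π M) ex (x M) k = 1) ∧
          FROG.cost (π M) ex (y M) = 0 ∧
          M ≤ FROG.cost (π M) ex (x M) := by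
  refine ⟨FilterGadget.gadget, fun _ => FilterGadget.index .x, fun _ => FilterGadget.index .y,
    FilterGadget.profile, 1, 4, one_pos, fun M hM => ⟨⟨?_, ?_, ?_, ?_⟩, ?_,
      FilterGadget.length_profile_x M, FilterGadget.profile_x_eq_profile_y M, ?_,
      congrArg FilterGadget.Agent.start (FilterGadget.role_index (M := M) .x),
      congrArg FilterGadget.Agent.start (FilterGadget.role_index (M := M) .y), fun ex h => ?_⟩⟩
  · change 1 * M ≤ 3 * M + 1
    omega
  · change 3 * M + 1 ≤ 4 * M
    omega
  · change 1 * M ^ 2 ≤ M * M + 2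
    nlinarith
  · change M * M + 2 ≤ 4 * M ^ 2
    nlinarith
  · intro hxy
    cases (FilterGadget.role_index (M := M) .x).symm.trans
      ((congrArg FilterGadget.role hxy).trans (FilterGadget.role_index .y))
  · intro e he
    obtain ⟨k, rfl⟩ := List.get_of_mem he
    obtain ⟨i, -, hi⟩ :=
      FilterGadget.edgeAt_of_role_eq_y_or_x (.inr (FilterGadget.role_index .x)) k
    exact ⟨rfl, (congrArg (FilterGadget.gadget M).d hi).trans (FilterGadget.d_chainEdge i)⟩
  · have hy (k) : FROG.waitTime _ ex (FilterGadget.index .y) k = 0 := by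
      obtain ⟨hjoin, hent⟩ := FilterGadget.times_y h (FilterGadget.role_index .y) k
      exact (congrArg₂ (· - ·) hent hjoin).trans (Nat.sub_self 0)
    have hx (k) : FROG.waitTime _ ex (FilterGadget.index .x) k = 1 := by
      obtain ⟨hjoin, hent⟩ := FilterGadget.times_x h (FilterGadget.role_index .x) k
      exact (congrArg₂ (· - ·) hent hjoin).trans (Nat.add_sub_cancel_left _ _)
    refine ⟨hy, hx, Finset.sum_eq_zero fun k _ => ?_, ?_⟩
    · obtain ⟨i, -, hi⟩ :=
        FilterGadget.edgeAt_of_role_eq_y_or_x (.inl (FilterGadget.role_index .y)) k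
      rw [hy, hi, FilterGadget.d_chainEdge, Nat.add_zero]
    · calc M = ∑ _k : Fin (FilterGadget.profile M (FilterGadget.index .x)).val.length, 1 := by
            rw [Finset.sum_const, Finset.card_univ, Fintype.card_fin,
              FilterGadget.length_profile_x, smul_eq_mul, mul_one]
        _ ≤ _ := Finset.sum_le_sum fun k _ => (hx k).ge.trans (Nat.le_add_right _ _)
end

section
/- When strategies are allowed to be walks (not necessarily simple paths), GPS-agents may cycle infinitely: there exists a FROG — the double cycle of infinite procrastination of Fig. 7 — together with an infinite play in which, at every decision point, each agent's move is consistent with the GPS rule (the chosen next edge lies on a path to its sink of minimum estimated delay, with estimated delay of an edge e equal to d_e plus the congestion ⌊|q_e|/c_e⌋ of the previous time step), and yet no agent ever reaches its sink. -/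
namespace FROG

/-- An infinite play in which every agent follows an infinite *walk* (a stream
of consecutive edges, repetitions allowed), recording for every agent `i` and
every step `k` of its walk the time at which it joins the queue of its `k`-th
edge and the time at which it enters that edge. -/
structure WalkPlay (Γ : FROG) where
  walk : Fin Γ.n → ℕ → Γ.Edge
  join : Fin Γ.n → ℕ → ℕ
  enter : Fin Γ.n → ℕ → ℕ

variable {Γ : FROG}

/-- `(j,l)` is queued ahead of `(i,k)` on the same edge in the walk play. -/
def WAhead (pl : WalkPlay Γ) (j : Fin Γ.n) (l : ℕ) (i : Fin Γ.n) (k : ℕ) : Prop :=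
  pl.walk j l = pl.walk i k ∧ (j ≠ i ∨ l ≠ k) ∧
    (pl.join j l < pl.join i k ∨
      (pl.join j l = pl.join i k ∧ Γ.prio j < Γ.prio i))

/-- The FIFO dynamics for infinite walks (walks are consistent with the
digraph; join/enter times obey the FIFO queueing discipline with capacities,
eager service and tie-breaking priorities; and time progresses: each agent
performs only finitely many steps up to any given time). -/
structure IsWalkFIFO (pl : WalkPlay Γ) : Prop where
  walk_src : ∀ i, (pl.walk i 0).1 = Γ.src i
  walk_chain : ∀ i k, (pl.walk i k).2 = (pl.walk i (k + 1)).1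
  walk_mem : ∀ i k, pl.walk i k ∈ Γ.E
  join_start : ∀ i, pl.join i 0 = Γ.start i
  join_le_enter : ∀ i k, pl.join i k ≤ pl.enter i k
  transit : ∀ i k, pl.join i (k + 1) = pl.enter i k + Γ.d (pl.walk i k)
  no_overtake : ∀ j l i k, WAhead pl j l i k → pl.enter j l ≤ pl.enter i k
  capacity : ∀ (e : Γ.Edge) (t : ℕ),
    Nat.card {p : Fin Γ.n × ℕ //
      pl.walk p.1 p.2 = e ∧ pl.enter p.1 p.2 = t} ≤ Γ.c e
  eager : ∀ i k (t : ℕ), pl.join i k ≤ t → t < pl.enter i k →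
    Γ.c (pl.walk i k) ≤ Nat.card {p : Fin Γ.n × ℕ //
      WAhead pl p.1 p.2 i k ∧ pl.enter p.1 p.2 = t}
  progress : ∀ i (t : ℕ), ∃ K, ∀ k, K ≤ k → t < pl.join i k

/-- The queue length `|q_e|` of edge `e` at time step `t` in a walk play. -/
noncomputable def wqueue (pl : WalkPlay Γ) (e : Γ.Edge) (t : ℕ) : ℕ :=
  Nat.card {p : Fin Γ.n × ℕ //
    pl.walk p.1 p.2 = e ∧ pl.join p.1 p.2 ≤ t ∧ t ≤ pl.enter p.1 p.2}

/-- GPS estimated delay, at a decision taken at time `t`, of a route `p`: the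
sum over its edges of the fixed delay `d_e` plus the congestion
`⌊|q_e| / c_e⌋` observed at the previous time step. -/
noncomputable def westimate (pl : WalkPlay Γ) (t : ℕ) (p : List Γ.Edge) : ℕ :=
  (p.map fun e => Γ.d e + wqueue pl e (t - 1) / Γ.c e).sum

/-- GPS-consistency of a walk play: whenever agent `i` stands at a vertex and
chooses its next edge (the `k`-th edge of its walk, chosen at the time it
joins that edge's queue), the chosen edge is the first edge of a path to its
sink of minimum estimated delay, the estimate of an edge being its fixed delay
plus the congestion of the previous time step. -/
def GPSConsistentWalk (pl : WalkPlay Γ) : Prop :=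
  ∀ (i : Fin Γ.n) (k : ℕ),
    ∃ p : List Γ.Edge,
      Γ.IsPathFrom (pl.walk i k).1 (Γ.sink i) p ∧
      p.head? = some (pl.walk i k) ∧
      ∀ p' : List Γ.Edge, Γ.IsPathFrom (pl.walk i k).1 (Γ.sink i) p' →
        westimate pl (pl.join i k) p ≤ westimate pl (pl.join i k) p'

end FROG

/-! The double cycle: layer `0` is the inner cycle and layer `1` the outer one. In every corner each
cycle has an arrival vertex and a departure vertex. An agent of one layer exits from the arrival
vertices of the other layer, so from its own arrival vertex it must cross to the departure
vertex of the other layer and use the long edge leaving it. -/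

namespace DoubleCycle

open FROG

/-- The arrival vertex (`x = 0`) or departure vertex (`x = 1`) of cycle `l` in corner `c`. -/
def corner (c : Fin 4) (l x : Fin 2) : Fin 18 :=
  ⟨4 * c.val + 2 * l.val + x.val, by omega⟩

/-- The sink of the agents of cycle `l`. -/
def exitVertex (l : Fin 2) : Fin 18 := ⟨16 + l.val, by omega⟩

/-- The edge of cycle `l` inside corner `c`. -/
def inside (c : Fin 4) (l : Fin 2) : Fin 18 × Fin 18 := (corner c l 0, corner c l 1)

/-- The edge of cycle `l` from corner `c` to the next corner. -/
def onward (c : Fin 4) (l : Fin 2) : Fin 18 × Fin 18 := (corner c l 1, corner (c + 1) l 0)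

/-- The edge in corner `c` from cycle `l` to the other cycle. -/
def cross (c : Fin 4) (l : Fin 2) : Fin 18 × Fin 18 := (corner c l 0, corner c (l + 1) 1)

/-- The edge from cycle `l` in corner `c` to the sink of the agents of the other cycle. -/
def escape (c : Fin 4) (l : Fin 2) : Fin 18 × Fin 18 := (corner c l 0, exitVertex (l + 1))

/-- The edges of the double cycle. -/
def edges : Finset (Fin 18 × Fin 18) :=
  Finset.univ.filter fun e => ∃ c l, e = inside c l ∨ e = onward c l ∨ e = cross c l ∨ e = escape c l

/-- The fixed delays: `1` on the edges between corners and `0` elsewhere. -/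
def fixedDelay (e : Fin 18 × Fin 18) : ℕ := if e.1.val % 2 = 1 then 1 else 0

/-- The cycle used by agent `i`. -/
def layer (i : Fin 4) : Fin 2 := Fin.ofNat 2 i.val

/-- The corner from which agent `i` departs at time `t`. -/
def position (i : Fin 4) (t : ℕ) : Fin 4 := Fin.ofNat 4 (i.val + t)

/-- The double cycle of infinite procrastination. Agent `i` starts at the departure vertex of
corner `i`; even agents use the inner cycle and odd agents the outer one. -/
abbrev game : FROG where
  nV := 18
  E := edges
  c := fun _ => 1
  d := fixedDelay
  n := 4
  src := fun i => corner i (layer i) 1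
  sink := fun i => exitVertex (layer i)
  start := fun _ => 0
  prio := Fin.val
  prio_inj := Fin.val_injective
  c_pos := fun _ _ => le_rfl

/-- The play in which every agent stays on its own cycle forever and never waits. -/
abbrev play : WalkPlay game where
  walk := fun i k =>
    if k % 2 = 0 then onward (position i ((k + 1) / 2)) (layer i)
    else inside (position i ((k + 1) / 2)) (layer i)
  join := fun _ k => (k + 1) / 2
  enter := fun _ k => (k + 1) / 2

lemma onward_inj : ∀ c l c' l', onward c l = onward c' l' → c = c' ∧ l = l' := by decide

lemma inside_inj : ∀ c l c' l', inside c l = inside c' l' → c = c' ∧ l = l' := by decide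

lemma onward_ne_inside : ∀ c l c' l', onward c l ≠ inside c' l' := by decide

lemma onward_ne_cross : ∀ c l c' l', onward c l ≠ cross c' l' := by decide

lemma inside_ne_cross : ∀ c l c' l', inside c l ≠ cross c' l' := by decide

lemma onward_ne_escape : ∀ c l c' l', onward c l ≠ escape c' l' := by decide

lemma inside_ne_escape : ∀ c l c' l', inside c l ≠ escape c' l' := by decide

lemma fixedDelay_inside : ∀ c l, fixedDelay (inside c l) = 0 := by decide

lemma fixedDelay_onward : ∀ c l, fixedDelay (onward c l) = 1 := by decide

lemma fixedDelay_cross : ∀ c l, fixedDelay (cross c l) = 0 := by decide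

lemma fixedDelay_escape : ∀ c l, fixedDelay (escape c l) = 0 := by decide

lemma mem_edges {e : Fin 18 × Fin 18} :
    e ∈ edges ↔ ∃ c l, e = inside c l ∨ e = onward c l ∨ e = cross c l ∨ e = escape c l := by
  simp [edges]

lemma val_position (i : Fin 4) (t : ℕ) : (position i t).val = (i.val + t) % 4 := rfl

lemma val_layer (i : Fin 4) : (layer i).val = i.val % 2 := rfl

lemma position_succ (i : Fin 4) (t : ℕ) : position i (t + 1) = position i t + 1 := by
  ext
  simp only [val_position, Fin.val_add]
  simp
  omega

lemma eq_of_position_eq {i j : Fin 4} {t : ℕ} (h : position i t = position j t) : i = j := by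
  have := congrArg Fin.val h
  simp only [val_position] at this
  omega

/-- Agents of cycle `l` visit a corner only at times of one parity. -/
lemma parity_position (i : Fin 4) (t : ℕ) :
    ((position i t).val + t + (layer i).val) % 2 = 0 := by
  simp only [val_position, val_layer]
  omega

lemma walk_eq (i : Fin 4) (k : ℕ) :
    (k % 2 = 0 ∧ play.walk i k = onward (position i ((k + 1) / 2)) (layer i)) ∨
      (k % 2 = 1 ∧ play.walk i k = inside (position i ((k + 1) / 2)) (layer i)) := by
  rcases Nat.mod_two_eq_zero_or_one k with h | h <;> simp [h]

lemma walk_join_inj {i j : Fin 4} {k m : ℕ} (hw : play.walk i k = play.walk j m)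
    (ht : (k + 1) / 2 = (m + 1) / 2) : i = j ∧ k = m := by
  rcases walk_eq i k with ⟨hk, h⟩ | ⟨hk, h⟩ <;> rcases walk_eq j m with ⟨hm, h'⟩ | ⟨hm, h'⟩ <;>
    rw [h, h', ht] at hw
  · exact ⟨eq_of_position_eq (onward_inj _ _ _ _ hw).1, by omega⟩
  · exact absurd hw (onward_ne_inside _ _ _ _)
  · exact absurd hw.symm (onward_ne_inside _ _ _ _)
  · exact ⟨eq_of_position_eq (inside_inj _ _ _ _ hw).1, by omega⟩

lemma wqueue_eq_zero {e : Fin 18 × Fin 18} {t : ℕ}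
    (h : ∀ (i : Fin 4) (k : ℕ), (k + 1) / 2 = t → play.walk i k ≠ e) : wqueue play e t = 0 := by
  have : IsEmpty {p : Fin 4 × ℕ //
      play.walk p.1 p.2 = e ∧ play.join p.1 p.2 ≤ t ∧ t ≤ play.enter p.1 p.2} :=
    ⟨fun ⟨p, hw, h₁, h₂⟩ => h p.1 p.2 (le_antisymm h₁ h₂) hw⟩
  exact Nat.card_of_isEmpty

lemma wqueue_cross (c : Fin 4) (l : Fin 2) (t : ℕ) : wqueue play (cross c l) t = 0 := by
  refine wqueue_eq_zero fun i k _ => ?_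
  rcases walk_eq i k with ⟨_, h⟩ | ⟨_, h⟩ <;> rw [h]
  exacts [onward_ne_cross _ _ _ _, inside_ne_cross _ _ _ _]

lemma wqueue_escape (c : Fin 4) (l : Fin 2) (t : ℕ) : wqueue play (escape c l) t = 0 := by
  refine wqueue_eq_zero fun i k _ => ?_
  rcases walk_eq i k with ⟨_, h⟩ | ⟨_, h⟩ <;> rw [h]
  exacts [onward_ne_escape _ _ _ _, inside_ne_escape _ _ _ _]

lemma wqueue_onward_of_odd {c : Fin 4} {l : Fin 2} {t : ℕ} (hp : (c.val + t + l.val) % 2 = 1) :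
    wqueue play (onward c l) t = 0 := by
  refine wqueue_eq_zero fun i k ht hw => ?_
  have := parity_position i t
  rcases walk_eq i k with ⟨_, h⟩ | ⟨_, h⟩ <;> rw [h, ht] at hw
  · obtain ⟨rfl, rfl⟩ := onward_inj _ _ _ _ hw
    omega
  · exact onward_ne_inside _ _ _ _ hw.symm

lemma wqueue_inside_of_odd {c : Fin 4} {l : Fin 2} {t : ℕ} (hp : (c.val + t + l.val) % 2 = 1) :
    wqueue play (inside c l) t = 0 := by
  refine wqueue_eq_zero fun i k ht hw => ?_
  have := parity_position i t
  rcases walk_eq i k with ⟨_, h⟩ | ⟨_, h⟩ <;> rw [h, ht] at hw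
  · exact onward_ne_inside _ _ _ _ hw
  · obtain ⟨rfl, rfl⟩ := inside_inj _ _ _ _ hw
    omega

lemma one_le_wqueue_onward {c : Fin 4} {l : Fin 2} {t : ℕ} (hp : (c.val + t + l.val) % 2 = 0) :
    1 ≤ wqueue play (onward c l) t := by
  have hsub : Subsingleton {p : Fin 4 × ℕ // play.walk p.1 p.2 = onward c l ∧
      play.join p.1 p.2 ≤ t ∧ t ≤ play.enter p.1 p.2} := by
    refine ⟨fun ⟨p, hp, h₁, h₂⟩ ⟨q, hq, h₃, h₄⟩ => Subtype.ext ?_⟩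
    have := walk_join_inj (hp.trans hq.symm) ((le_antisymm h₁ h₂).trans (le_antisymm h₄ h₃))
    exact Prod.ext this.1 this.2
  have hne : Nonempty {p : Fin 4 × ℕ // play.walk p.1 p.2 = onward c l ∧
      play.join p.1 p.2 ≤ t ∧ t ≤ play.enter p.1 p.2} := by
    have ht : (2 * t + 1) / 2 = t := by omega
    refine ⟨⟨(⟨(c.val + 3 * t) % 4, by omega⟩, 2 * t), ?_, ht.le, ht.ge⟩⟩
    have hpos : position ⟨(c.val + 3 * t) % 4, by omega⟩ t = c := by
      ext
      simp only [val_position]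
      omega
    have hlay : layer ⟨(c.val + 3 * t) % 4, by omega⟩ = l := by
      ext
      simp only [val_layer]
      omega
    simp [ht, hpos, hlay]
  exact Nat.card_pos

lemma isWalkFIFO_play : IsWalkFIFO play where
  walk_src i := by revert i; decide
  walk_chain i k := by
    rcases walk_eq i k with ⟨hk, h⟩ | ⟨hk, h⟩ <;>
      rcases walk_eq i (k + 1) with ⟨hk', h'⟩ | ⟨hk', h'⟩ <;> try omega
    · rw [h, h', show (k + 1 + 1) / 2 = (k + 1) / 2 + 1 by omega, position_succ]
      rfl
    · rw [h, h', show (k + 1 + 1) / 2 = (k + 1) / 2 by omega]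
      rfl
  walk_mem i k := by
    refine mem_edges.2 ⟨position i ((k + 1) / 2), layer i, ?_⟩
    rcases walk_eq i k with ⟨_, h⟩ | ⟨_, h⟩ 
    exacts [.inr (.inl h), .inl h]
  join_start _ := rfl
  join_le_enter _ _ := le_rfl
  transit i k := by
    rcases walk_eq i k with ⟨hk, h⟩ | ⟨hk, h⟩
    · rw [h, show game.d = fixedDelay from rfl, fixedDelay_onward]
      change (k + 1 + 1) / 2 = (k + 1) / 2 + 1
      omega
    · rw [h, show game.d = fixedDelay from rfl, fixedDelay_inside]
      change (k + 1 + 1) / 2 = (k + 1) / 2 + 0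
      omega
  no_overtake j m i k h := h.2.2.elim le_of_lt fun h => h.1.le
  capacity e t := by
    have : Subsingleton {p : Fin 4 × ℕ // play.walk p.1 p.2 = e ∧ play.enter p.1 p.2 = t} := by
      refine ⟨fun ⟨p, hp, h₁⟩ ⟨q, hq, h₂⟩ => Subtype.ext ?_⟩
      have := walk_join_inj (hp.trans hq.symm) (h₁.trans h₂.symm)
      exact Prod.ext this.1 this.2
    exact Finite.card_le_one_iff_subsingleton.2 this
  eager i k t h₁ h₂ := absurd h₁ (not_le.2 h₂)
  progress i t := ⟨2 * t + 1, fun k hk => by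
    change t < (k + 1) / 2
    omega⟩

/-- A lower bound for the estimated delay from `v` to the sink of cycle `l`, at a time at which an
agent of cycle `l` arrives in corner `c`. -/
def potential (c : Fin 4) (l : Fin 2) (v : Fin 18) : ℕ :=
  if v = exitVertex l then 0
  else if v = exitVertex (l + 1) then 2
  else if ∃ c', v = corner c' (l + 1) 0 then 0
  else if (v.val / 4 + c.val) % 2 = 0 then 2 else 1

lemma potential_le_of_mem {c : Fin 4} {l : Fin 2} {t : ℕ} (hp : (c.val + t + l.val) % 2 = 1)
    {e : Fin 18 × Fin 18} (he : e ∈ edges) :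
    potential c l e.1 ≤ game.d e + wqueue play e t / game.c e + potential c l e.2 := by
  have free : ∀ c l c' l', potential c l (inside c' l').1 ≤ potential c l (inside c' l').2 ∧
      potential c l (cross c' l').1 ≤ potential c l (cross c' l').2 ∧
      potential c l (escape c' l').1 ≤ potential c l (escape c' l').2 := by decide
  have long : ∀ c l c' l', potential c l (onward c' l').1 ≤
      game.d (onward c' l') + potential c l (onward c' l').2 +
        if (c'.val + c.val + l.val + l'.val) % 2 = 1 then 1 else 0 := by decide
  obtain ⟨c', l', rfl | rfl | rfl | rfl⟩ := mem_edges.1 he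
  · exact (free c l c' l').1.trans (Nat.le_add_left _ _)
  · refine (long c l c' l').trans ?_
    rw [show game.c (onward c' l') = 1 from rfl, Nat.div_one]
    split_ifs with h
    · have := one_le_wqueue_onward (c := c') (l := l') (t := t) (by omega)
      omega
    · omega
  · exact (free c l c' l').2.1.trans (Nat.le_add_left _ _)
  · exact (free c l c' l').2.2.trans (Nat.le_add_left _ _)

lemma potential_le_westimate {c : Fin 4} {l : Fin 2} {t : ℕ}
    (hp : (c.val + (t - 1) + l.val) % 2 = 1) (p : List game.Edge) (u : Fin 18)
    (h : game.IsPathFrom u (exitVertex l) p) : potential c l u ≤ westimate play t p := by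
  induction p generalizing u with
  | nil =>
    obtain rfl : u = exitVertex l := h
    simp [potential]
  | cons e p ih =>
    obtain ⟨rfl, he, h⟩ := h
    have := potential_le_of_mem hp he
    have := ih _ h
    simp only [westimate, List.map_cons, List.sum_cons] at *
    omega

/-- The route that stays on cycle `l` in corner `c` and exits from the next corner. -/
def procrastinate (c : Fin 4) (l : Fin 2) : List (Fin 18 × Fin 18) :=
  [inside c l, onward c l, cross (c + 1) l, onward (c + 1) (l + 1), escape (c + 2) (l + 1)]

lemma isPathFrom_procrastinate (c : Fin 4) (l : Fin 2) :
    game.IsPathFrom (inside c l).1 (exitVertex l) (procrastinate c l) := by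
  have ends : ∀ c l, (escape (c + 2) (l + 1)).1 = (onward (c + 1) (l + 1)).2 ∧
      (escape c (l + 1)).2 = exitVertex l := by decide
  have mem : ∀ c l, inside c l ∈ edges ∧ onward c l ∈ edges ∧ cross c l ∈ edges ∧
      escape c l ∈ edges := fun c l =>
    ⟨mem_edges.2 ⟨c, l, .inl rfl⟩, mem_edges.2 ⟨c, l, .inr (.inl rfl)⟩,
      mem_edges.2 ⟨c, l, .inr (.inr (.inl rfl))⟩, mem_edges.2 ⟨c, l, .inr (.inr (.inr rfl))⟩⟩
  refine ⟨rfl, (mem _ _).1, rfl, (mem _ _).2.1, rfl, (mem _ _).2.2.1, rfl, (mem _ _).2.1,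
    (ends c l).1, (mem _ _).2.2.2, (ends _ l).2⟩

lemma westimate_procrastinate {c : Fin 4} {l : Fin 2} {t : ℕ}
    (hp : (c.val + (t - 1) + l.val) % 2 = 1) : westimate play t (procrastinate c l) = 2 := by
  have parity_succ : ∀ (c : Fin 4) (l : Fin 2),
      ((c + 1).val + (l + 1).val) % 2 = (c.val + l.val) % 2 := by decide
  have := parity_succ c l
  simp only [westimate, procrastinate, List.map_cons, List.map_nil, List.sum_cons, List.sum_nil,
    wqueue_inside_of_odd hp, wqueue_onward_of_odd hp, wqueue_cross, wqueue_escape,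
    wqueue_onward_of_odd (c := c + 1) (l := l + 1) (t := t - 1) (by omega), fixedDelay_inside,
    fixedDelay_onward, fixedDelay_cross, fixedDelay_escape, Nat.zero_div, Nat.reduceAdd]

/-- A departure vertex has only one outgoing edge. -/
lemma eq_onward_of_mem {c : Fin 4} {l : Fin 2} {e : Fin 18 × Fin 18} (he : e ∈ edges)
    (h : e.1 = (onward c l).1) : e = onward c l := by
  have tails : ∀ c l c' l', corner c' l' 0 ≠ (onward c l).1 ∧
      ((onward c' l').1 = (onward c l).1 → onward c' l' = onward c l) := by decide
  obtain ⟨c', l', rfl | rfl | rfl | rfl⟩ := mem_edges.1 he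
  · exact absurd h (tails c l c' l').1
  · exact (tails c l c' l').2 h
  · exact absurd h (tails c l c' l').1
  · exact absurd h (tails c l c' l').1

lemma gpsConsistentWalk_play : GPSConsistentWalk play := by
  intro i k
  rcases walk_eq i k with ⟨hk, h⟩ | ⟨hk, h⟩
  · rw [h]
    set c := position i ((k + 1) / 2)
    have hne : {p | game.IsPathFrom (onward c (layer i)).1 (exitVertex (layer i)) p}.Nonempty :=
      ⟨onward c (layer i) :: procrastinate (c + 1) (layer i), rfl,
        mem_edges.2 ⟨_, _, .inr (.inl rfl)⟩, isPathFrom_procrastinate _ _⟩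
    obtain ⟨p, hp, hmin⟩ :=
      exists_minimalFor_of_wellFoundedLT _ (westimate play (play.join i k)) hne
    refine ⟨p, hp, ?_, fun p' hp' => (le_total _ _).elim id (hmin hp')⟩
    cases p with
    | nil =>
      have corner_ne : ∀ c l l', (onward c l).1 ≠ exitVertex l' := by decide
      exact absurd hp (corner_ne _ _ _)
    | cons e p => exact congrArg some (eq_onward_of_mem hp.2.1 hp.1)
  · rw [h]
    have hp : ((position i ((k + 1) / 2)).val + ((k + 1) / 2 - 1) + (layer i).val) % 2 = 1 := by
      have := parity_position i ((k + 1) / 2)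
      omega
    refine ⟨procrastinate _ _, isPathFrom_procrastinate _ _, rfl, fun p' hp' => ?_⟩
    have start : ∀ c l, potential c l (inside c l).1 = 2 := by decide
    rw [westimate_procrastinate hp, ← start (position i ((k + 1) / 2)) (layer i)]
    exact potential_le_westimate hp p' _ hp'

end DoubleCycle

/-- When strategies are allowed to be walks (not necessarily
simple paths), GPS-agents may cycle infinitely: there exists a FROG — the
double cycle of infinite procrastination of Fig. 7 — together with an infinite
play in which, at every decision point, each agent's move is consistent with
the GPS rule (the chosen next edge lies on a path to its sink of minimum
estimated delay, the estimated delay of an edge `e` being `d_e` plus the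
congestion `⌊|q_e| / c_e⌋` of the previous time step), and yet no agent ever
reaches its sink. -/
theorem gps_agents_may_cycle_infinitely :
    ∃ (Γ : FROG) (pl : FROG.WalkPlay Γ),
      0 < Γ.n ∧
      FROG.IsWalkFIFO pl ∧
      FROG.GPSConsistentWalk pl ∧
      (∀ i : Fin Γ.n, Γ.src i ≠ Γ.sink i) ∧
      (∀ (i : Fin Γ.n) (k : ℕ), (pl.walk i k).2 ≠ Γ.sink i) := by
  refine ⟨DoubleCycle.game, DoubleCycle.play, by decide, DoubleCycle.isWalkFIFO_play,
    DoubleCycle.gpsConsistentWalk_play, by decide, fun i k => ?_⟩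
  have onward_ne : ∀ c l l', (DoubleCycle.onward c l).2 ≠ DoubleCycle.exitVertex l' := by decide
  have inside_ne : ∀ c l l', (DoubleCycle.inside c l).2 ≠ DoubleCycle.exitVertex l' := by decide
  rcases DoubleCycle.walk_eq i k with ⟨_, h⟩ | ⟨_, h⟩ <;> rw [h]
  exacts [onward_ne _ _ _, inside_ne _ _ _]
end
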